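/- Let n ≥ 1 and let A be an elasticity Z-tensor. Then: (i) A is a nonsingular elasticity M-tensor if and only if there exists c > 0 such that A x² y² ≥ c for all x, y ∈ ℝ^n with x ≥ 0, y ≥ 0 and xᵀx = yᵀy = 1 (equivalently, the infimum of A x² y² over such pairs is positive); (ii) A is an elasticity M-tensor if and only if A x² y² ≥ 0 for all x, y ∈ ℝ^n with x ≥ 0, y ≥ 0 and xᵀx = yᵀy = 1. -/

import Mathlib

open Finset

noncomputable section

/-- Symmetry condition of an elasticity tensor: `a_{ijkl} = a_{jikl} = a_{ijlk}`. -/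
def ElastSym {n : ℕ} (A : Fin n → Fin n → Fin n → Fin n → ℝ) : Prop :=
  ∀ i j k l, A i j k l = A j i k l ∧ A i j k l = A i j l k

/-- The scalar `A x² y² = ∑ a_{ijkl} x_i x_j y_k y_l`. -/
def tQuad {n : ℕ} (A : Fin n → Fin n → Fin n → Fin n → ℝ) (x y : Fin n → ℝ) : ℝ :=
  ∑ i, ∑ j, ∑ k, ∑ l, A i j k l * x i * x j * y k * y l

/-- The vector `(A x y²)_i = ∑ a_{ijkl} x_j y_k y_l`. -/
def tAxyy {n : ℕ} (A : Fin n → Fin n → Fin n → Fin n → ℝ) (x y : Fin n → ℝ) : Fin n → ℝ :=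
  fun i => ∑ j, ∑ k, ∑ l, A i j k l * x j * y k * y l

/-- The vector `(A x² y)_l = ∑ a_{ijkl} x_i x_j y_k`. -/
def tAxxy {n : ℕ} (A : Fin n → Fin n → Fin n → Fin n → ℝ) (x y : Fin n → ℝ) : Fin n → ℝ :=
  fun l => ∑ i, ∑ j, ∑ k, A i j k l * x i * x j * y k

/-- The matrix `(A x²)_{kl} = ∑ a_{ijkl} x_i x_j`. -/
def matAx2 {n : ℕ} (A : Fin n → Fin n → Fin n → Fin n → ℝ) (x : Fin n → ℝ) :
    Matrix (Fin n) (Fin n) ℝ :=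
  Matrix.of fun k l => ∑ i, ∑ j, A i j k l * x i * x j

/-- The matrix `(A y²)_{ij} = ∑ a_{ijkl} y_k y_l`. -/
def matAy2 {n : ℕ} (A : Fin n → Fin n → Fin n → Fin n → ℝ) (y : Fin n → ℝ) :
    Matrix (Fin n) (Fin n) ℝ :=
  Matrix.of fun i j => ∑ k, ∑ l, A i j k l * y k * y l

/-- The identity tensor `e_{ijkl} = 1` iff `i = j` and `k = l`. -/
def idT (n : ℕ) : Fin n → Fin n → Fin n → Fin n → ℝ :=
  fun i j k l => if i = j ∧ k = l then 1 else 0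

/-- `xᵀ x = 1`. -/
def unitVec {n : ℕ} (x : Fin n → ℝ) : Prop := ∑ i, x i * x i = 1

/-- `(λ, x, y)` is an M-eigenpair of `A`. -/
def IsMEig {n : ℕ} (A : Fin n → Fin n → Fin n → Fin n → ℝ) (lam : ℝ) (x y : Fin n → ℝ) :
    Prop :=
  (∀ i, tAxyy A x y i = lam * x i) ∧ (∀ l, tAxxy A x y l = lam * y l) ∧
    unitVec x ∧ unitVec y

/-- M-positive definiteness (the strong ellipticity condition). -/
def MPD {n : ℕ} (A : Fin n → Fin n → Fin n → Fin n → ℝ) : Prop :=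
  ∀ x y : Fin n → ℝ, x ≠ 0 → y ≠ 0 → 0 < tQuad A x y

/-- M-positive semidefiniteness. -/
def MPSD {n : ℕ} (A : Fin n → Fin n → Fin n → Fin n → ℝ) : Prop :=
  ∀ x y : Fin n → ℝ, 0 ≤ tQuad A x y

/-- All entries are nonnegative. -/
def NonnegT {n : ℕ} (A : Fin n → Fin n → Fin n → Fin n → ℝ) : Prop :=
  ∀ i j k l, 0 ≤ A i j k l

/-- The M-spectral radius of a nonnegative elasticity tensor:
`sup { B x² y² : xᵀx = yᵀy = 1 }`. -/
def rhoM {n : ℕ} (B : Fin n → Fin n → Fin n → Fin n → ℝ) : ℝ :=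
  sSup { r : ℝ | ∃ x y : Fin n → ℝ, unitVec x ∧ unitVec y ∧ r = tQuad B x y }

/-- An elasticity Z-tensor: all off-diagonal entries nonpositive. -/
def ZTensor {n : ℕ} (A : Fin n → Fin n → Fin n → Fin n → ℝ) : Prop :=
  ∀ i j k l, ¬(i = j ∧ k = l) → A i j k l ≤ 0

/-- A nonsingular elasticity M-tensor: `A = s E - B` with `B` nonnegative and `s > ρ_M(B)`. -/
def NonsingMT {n : ℕ} (A : Fin n → Fin n → Fin n → Fin n → ℝ) : Prop :=
  ∃ (s : ℝ) (B : Fin n → Fin n → Fin n → Fin n → ℝ),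
    ElastSym B ∧ NonnegT B ∧ (∀ i j k l, A i j k l = s * idT n i j k l - B i j k l) ∧
      rhoM B < s

/-- An elasticity M-tensor: `A = s E - B` with `B` nonnegative and `s ≥ ρ_M(B)`. -/
def ElastMT {n : ℕ} (A : Fin n → Fin n → Fin n → Fin n → ℝ) : Prop :=
  ∃ (s : ℝ) (B : Fin n → Fin n → Fin n → Fin n → ℝ),
    ElastSym B ∧ NonnegT B ∧ (∀ i j k l, A i j k l = s * idT n i j k l - B i j k l) ∧
      rhoM B ≤ s

/-- Irreducibility of a (nonnegative) square matrix. -/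
def MatIrred {n : ℕ} (M : Matrix (Fin n) (Fin n) ℝ) : Prop :=
  ∀ S : Finset (Fin n), S.Nonempty → S ≠ Finset.univ → ∃ k ∈ S, ∃ l ∉ S, M k l ≠ 0

/-- Strict diagonal dominance. -/
def SDD {n : ℕ} (M : Matrix (Fin n) (Fin n) ℝ) : Prop :=
  ∀ i, ∑ j ∈ Finset.univ.erase i, |M i j| < |M i i|

theorem unitVec.abs_le_one {n : ℕ} {x : Fin n → ℝ} (hx : unitVec x) (i : Fin n) : |x i| ≤ 1 := by
  have h : x i * x i ≤ ∑ j, x j * x j :=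
    Finset.single_le_sum (f := fun j => x j * x j) (fun j _ => mul_self_nonneg (x j))
      (Finset.mem_univ i)
  rw [unitVec] at hx
  rw [hx] at h
  exact abs_le_one_iff_mul_self_le_one.mpr h

theorem unitVec.abs {n : ℕ} {x : Fin n → ℝ} (hx : unitVec x) : unitVec fun i => |x i| := by
  simpa [unitVec] using hx

theorem unitVec_single {n : ℕ} (i : Fin n) : unitVec (Pi.single i (1 : ℝ)) := by
  simp [unitVec, Pi.single_apply]

theorem tQuad_idT {n : ℕ} {x y : Fin n → ℝ} (hx : unitVec x) (hy : unitVec y) :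
    tQuad (idT n) x y = 1 := by
  have h (i j k l : Fin n) : idT n i j k l * x i * x j * y k * y l
      = if i = j then (if k = l then x i * x j * (y k * y l) else 0) else 0 := by
    by_cases hij : i = j <;> by_cases hkl : k = l <;> simp [idT, hij, hkl, mul_assoc]
  unfold unitVec at hx hy
  have h' (i j : Fin n) : ∑ k, ∑ l, idT n i j k l * x i * x j * y k * y l
      = if i = j then x i * x j else 0 := by
    simp only [h]
    by_cases hij : i = j
    · simp [hij, ← Finset.mul_sum, hy]
    · simp [hij]
  simp [tQuad, h', hx]

theorem tQuad_smul_idT_sub {n : ℕ} {A B : Fin n → Fin n → Fin n → Fin n → ℝ} {s : ℝ}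
    (h : ∀ i j k l, A i j k l = s * idT n i j k l - B i j k l) {x y : Fin n → ℝ}
    (hx : unitVec x) (hy : unitVec y) : tQuad A x y = s - tQuad B x y := by
  have key : tQuad A x y = s * tQuad (idT n) x y - tQuad B x y := by
    simp only [tQuad, h, sub_mul, Finset.sum_sub_distrib, Finset.mul_sum, mul_assoc]
  rw [key, tQuad_idT hx hy, mul_one]

theorem tQuad_le_tQuad_abs {n : ℕ} {B : Fin n → Fin n → Fin n → Fin n → ℝ} (hB : NonnegT B)
    (x y : Fin n → ℝ) : tQuad B x y ≤ tQuad B (fun i => |x i|) (fun i => |y i|) := by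
  unfold tQuad
  refine Finset.sum_le_sum fun i _ => Finset.sum_le_sum fun j _ =>
    Finset.sum_le_sum fun k _ => Finset.sum_le_sum fun l _ => ?_
  refine (le_abs_self _).trans_eq ?_
  rw [abs_mul, abs_mul, abs_mul, abs_mul, abs_of_nonneg (hB i j k l)]

theorem tQuad_le_rhoM {n : ℕ} {B : Fin n → Fin n → Fin n → Fin n → ℝ} (hB : NonnegT B)
    {x y : Fin n → ℝ} (hx : unitVec x) (hy : unitVec y) : tQuad B x y ≤ rhoM B := by
  refine le_csSup ⟨∑ i, ∑ j, ∑ k, ∑ l, B i j k l, ?_⟩ ⟨x, y, hx, hy, rfl⟩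
  rintro _ ⟨u, v, hu, hv, rfl⟩
  refine (tQuad_le_tQuad_abs hB u v).trans ?_
  unfold tQuad
  refine Finset.sum_le_sum fun i _ => Finset.sum_le_sum fun j _ =>
    Finset.sum_le_sum fun k _ => Finset.sum_le_sum fun l _ => ?_
  have h1 := mul_le_of_le_one_right (hB i j k l) (hu.abs_le_one i)
  have h2 := mul_le_of_le_one_right (mul_nonneg (hB i j k l) (abs_nonneg (u i))) (hu.abs_le_one j)
  have h3 := mul_le_of_le_one_right (mul_nonneg (mul_nonneg (hB i j k l) (abs_nonneg (u i)))
    (abs_nonneg (u j))) (hv.abs_le_one k)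
  have h4 := mul_le_of_le_one_right (mul_nonneg (mul_nonneg (mul_nonneg (hB i j k l)
    (abs_nonneg (u i))) (abs_nonneg (u j))) (abs_nonneg (v k))) (hv.abs_le_one l)
  exact h4.trans (h3.trans (h2.trans h1))

theorem ZTensor.exists_nonnegT {n : ℕ} {A : Fin n → Fin n → Fin n → Fin n → ℝ}
    (hA : ElastSym A) (hZ : ZTensor A) :
    ∃ (s : ℝ) (B : Fin n → Fin n → Fin n → Fin n → ℝ), ElastSym B ∧ NonnegT B ∧
      ∀ i j k l, A i j k l = s * idT n i j k l - B i j k l := by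
  refine ⟨∑ i, ∑ k, |A i i k k|,
    fun i j k l => (∑ i, ∑ k, |A i i k k|) * idT n i j k l - A i j k l, ?_, ?_, ?_⟩
  · intro i j k l
    simp only [← (hA i j k l).1, ← (hA i j k l).2, idT, eq_comm, and_self]
  · intro i j k l
    by_cases h : i = j ∧ k = l
    · obtain ⟨rfl, rfl⟩ := h
      have h1 : |A i i k k| ≤ ∑ k, |A i i k k| :=
        Finset.single_le_sum (f := fun k => |A i i k k|) (fun _ _ => abs_nonneg _)
          (Finset.mem_univ k)
      have h2 : ∑ k, |A i i k k| ≤ ∑ i, ∑ k, |A i i k k| :=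
        Finset.single_le_sum (f := fun i => ∑ k, |A i i k k|)
          (fun _ _ => Finset.sum_nonneg fun _ _ => abs_nonneg _) (Finset.mem_univ i)
      simpa [idT] using (le_abs_self _).trans (h1.trans h2)
    · simpa [idT, h] using hZ i j k l h
  · intro i j k l
    ring

theorem rhoM_le_of_le_tQuad {n : ℕ} (hn : 1 ≤ n) {A B : Fin n → Fin n → Fin n → Fin n → ℝ}
    {s c : ℝ} (hB : NonnegT B) (h : ∀ i j k l, A i j k l = s * idT n i j k l - B i j k l)
    (hc : ∀ x y : Fin n → ℝ,
      (∀ i, 0 ≤ x i) → (∀ i, 0 ≤ y i) → unitVec x → unitVec y → c ≤ tQuad A x y) :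
    rhoM B ≤ s - c := by
  have e := unitVec_single (⟨0, hn⟩ : Fin n)
  refine csSup_le ⟨_, _, _, e, e, rfl⟩ ?_
  rintro _ ⟨x, y, hx, hy, rfl⟩
  have h1 := hc _ _ (fun i => abs_nonneg (x i)) (fun i => abs_nonneg (y i)) hx.abs hy.abs
  rw [tQuad_smul_idT_sub h hx.abs hy.abs] at h1
  linarith [tQuad_le_tQuad_abs hB x y]

/-- characterization of (nonsingular) elasticity M-tensors by the sign of
`A x² y²` over pairs of nonnegative unit vectors. -/
theorem stmt_15 {n : ℕ} (hn : 1 ≤ n) (A : Fin n → Fin n → Fin n → Fin n → ℝ)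
    (hA : ElastSym A) (hZ : ZTensor A) :
    (NonsingMT A ↔ ∃ c : ℝ, 0 < c ∧ ∀ x y : Fin n → ℝ,
        (∀ i, 0 ≤ x i) → (∀ i, 0 ≤ y i) → unitVec x → unitVec y → c ≤ tQuad A x y) ∧
    (ElastMT A ↔ ∀ x y : Fin n → ℝ,
        (∀ i, 0 ≤ x i) → (∀ i, 0 ≤ y i) → unitVec x → unitVec y → 0 ≤ tQuad A x y) := by
  obtain ⟨s, B, hBs, hB, h⟩ := hZ.exists_nonnegT hA
  refine ⟨⟨?_, ?_⟩, ⟨?_, ?_⟩⟩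
  · rintro ⟨t, C, -, hC, hAC, hlt⟩
    refine ⟨t - rhoM C, sub_pos.mpr hlt, fun x y _ _ hx hy => ?_⟩
    rw [tQuad_smul_idT_sub hAC hx hy]
    linarith [tQuad_le_rhoM hC hx hy]
  · rintro ⟨c, hc, hle⟩
    exact ⟨s, B, hBs, hB, h, by linarith [rhoM_le_of_le_tQuad hn hB h hle]⟩
  · rintro ⟨t, C, -, hC, hAC, hle⟩ x y _ _ hx hy
    rw [tQuad_smul_idT_sub hAC hx hy]
    linarith [tQuad_le_rhoM hC hx hy]
  · intro hle
    exact ⟨s, B, hBs, hB, h, by linarith [rhoM_le_of_le_tQuad hn hB h hle]⟩
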